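/- arXiv:2309.16384 — 5 statements merged into one kernel-verified Lean document; each statement's English description precedes it below -/
import Mathlib

section
/- Let δ ∈ (0, 1] and α > 2 + 3δ be reals. Let Q be a finite nonempty set of points in EuclideanSpace ℝ (Fin d) with centroid μ(Q) and radius ρ(Q). Let c be a point with cost(Q, c) ≥ α · cost(Q, μ(Q)) and let q be a point with ‖q − μ(Q)‖ ≤ (1 + δ) · ρ(Q). Then ‖q − c‖² ≥ (√(α − 1) − (1 + δ))² · ρ(Q)². -/
/-- `cost Q c = ∑_{q ∈ Q} ‖q - c‖²` -/
noncomputable def cost {d : ℕ} (Q : Finset (EuclideanSpace ℝ (Fin d)))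
    (c : EuclideanSpace ℝ (Fin d)) : ℝ := ∑ q ∈ Q, ‖q - c‖ ^ 2

/-- `mu Q` is the centroid (mean) of the finite set `Q`. -/
noncomputable def mu {d : ℕ} (Q : Finset (EuclideanSpace ℝ (Fin d))) :
    EuclideanSpace ℝ (Fin d) := (Q.card : ℝ)⁻¹ • ∑ q ∈ Q, q

theorem sum_sub_mu {d : ℕ} {Q : Finset (EuclideanSpace ℝ (Fin d))} (hQ : Q.Nonempty) :
    ∑ q ∈ Q, (q - mu Q) = 0 := by
  have h : (Q.card : ℝ) ≠ 0 := by exact_mod_cast hQ.card_ne_zero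
  rw [Finset.sum_sub_distrib, Finset.sum_const, ← Nat.cast_smul_eq_nsmul ℝ, mu,
    smul_inv_smul₀ h, sub_self]

/-- Moving the center away from the centroid raises the cost by `|Q|` times the squared distance. -/
theorem cost_eq_cost_mu_add {d : ℕ} {Q : Finset (EuclideanSpace ℝ (Fin d))} (hQ : Q.Nonempty)
    (c : EuclideanSpace ℝ (Fin d)) :
    cost Q c = cost Q (mu Q) + Q.card * ‖mu Q - c‖ ^ 2 := by
  have h (q : EuclideanSpace ℝ (Fin d)) : ‖q - c‖ ^ 2 =
      ‖q - mu Q‖ ^ 2 + 2 * inner ℝ (q - mu Q) (mu Q - c) + ‖mu Q - c‖ ^ 2 := by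
    rw [← norm_add_sq_real, sub_add_sub_cancel]
  rw [cost, Finset.sum_congr rfl fun q _ ↦ h q]
  simp only [cost, Finset.sum_add_distrib, ← Finset.mul_sum, ← sum_inner, sum_sub_mu hQ,
    inner_zero_left, Finset.sum_const, nsmul_eq_mul, mul_zero, add_zero]

/-- Every point of the δ-core is far from every expensive center:
if `cost(Q, c) ≥ α · cost(Q, μ(Q))` with `α > 2 + 3δ`, `δ ∈ (0,1]`, and
`‖q − μ(Q)‖ ≤ (1 + δ)·ρ(Q)`, then `‖q − c‖² ≥ (√(α−1) − (1+δ))² · ρ(Q)²`. -/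
theorem core_far_from_expensive_center {d : ℕ} (δ α : ℝ) (hδ0 : 0 < δ) (hδ1 : δ ≤ 1)
    (hα : α > 2 + 3 * δ)
    (Q : Finset (EuclideanSpace ℝ (Fin d))) (hQ : Q.Nonempty)
    (ρ : ℝ) (hρ0 : 0 ≤ ρ) (hρ : ρ ^ 2 * (Q.card : ℝ) = cost Q (mu Q))
    (c : EuclideanSpace ℝ (Fin d)) (hc : cost Q c ≥ α * cost Q (mu Q))
    (q : EuclideanSpace ℝ (Fin d)) (hq : ‖q - mu Q‖ ≤ (1 + δ) * ρ) :
    ‖q - c‖ ^ 2 ≥ (Real.sqrt (α - 1) - (1 + δ)) ^ 2 * ρ ^ 2 := by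
  have hcard : (0 : ℝ) < Q.card := by exact_mod_cast hQ.card_pos
  have hsqrt : 1 + δ ≤ √(α - 1) := Real.le_sqrt_of_sq_le (by nlinarith)
  have hdist_sq : (α - 1) * ρ ^ 2 ≤ ‖mu Q - c‖ ^ 2 := by
    rw [cost_eq_cost_mu_add hQ, ← hρ] at hc
    refine le_of_mul_le_mul_left ?_ hcard
    linarith
  have hdist : √(α - 1) * ρ ≤ ‖mu Q - c‖ := by
    refine (sq_le_sq₀ (by positivity) (norm_nonneg _)).1 ?_
    rwa [mul_pow, Real.sq_sqrt (by linarith)]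
  have htri : ‖mu Q - c‖ ≤ ‖q - mu Q‖ + ‖q - c‖ := by
    rw [norm_sub_rev q (mu Q)]
    exact norm_sub_le_norm_sub_add_norm_sub _ _ _
  rw [ge_iff_le, ← mul_pow]
  exact pow_le_pow_left₀ (mul_nonneg (sub_nonneg.2 hsqrt) hρ0) (by linarith) 2
end

section
/- Let t ≥ 0 be a real. Let P be a finite set of points in EuclideanSpace ℝ (Fin d), let C be a finite set of points and Out ⊆ C with C \ Out nonempty. Let O₁, …, O_s be pairwise disjoint finite nonempty subsets of P, write O_In := O₁ ∪ ⋯ ∪ O_s, and let ô₁, …, ô_s be points and B₁, …, B_s reals such that cost(O_i, (C \ Out) ∪ {ô_i}) ≤ B_i for each i. Set reassign := cost(P \ O_In, C \ Out) − cost(P \ O_In, C). If cost(P, (C \ Out) ∪ {ô₁, …, ô_s}) > cost(P, C) − t, then cost(O_In, C) ≤ Σ_{i=1}^{s} B_i + reassign + t. -/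
open Finset

/-- `costS Q C = ∑_{q ∈ Q} min_{c ∈ C} ‖q - c‖²` (for nonempty `C`). -/
noncomputable def costS {d : ℕ} (Q C : Finset (EuclideanSpace ℝ (Fin d))) : ℝ :=
  ∑ q ∈ Q, sInf ((fun c => ‖q - c‖ ^ 2) '' (C : Set (EuclideanSpace ℝ (Fin d))))

theorem costS_anti {d : ℕ} (Q : Finset (EuclideanSpace ℝ (Fin d)))
    {C D : Finset (EuclideanSpace ℝ (Fin d))} (hC : C.Nonempty) (hCD : C ⊆ D) :
    costS Q D ≤ costS Q C := by
  refine Finset.sum_le_sum fun q _ => ?_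
  refine csInf_le_csInf ?_ ((Finset.coe_nonempty.mpr hC).image _)
    (Set.image_mono (Finset.coe_subset.mpr hCD))
  exact (D.finite_toSet.image _).bddBelow

theorem costS_sdiff_add {d : ℕ} [DecidableEq (EuclideanSpace ℝ (Fin d))]
    {Q P : Finset (EuclideanSpace ℝ (Fin d))} (C : Finset (EuclideanSpace ℝ (Fin d)))
    (hQP : Q ⊆ P) : costS (P \ Q) C + costS Q C = costS P C :=
  Finset.sum_sdiff hQP

theorem costS_biUnion {d s : ℕ} [DecidableEq (EuclideanSpace ℝ (Fin d))]
    (O : Fin s → Finset (EuclideanSpace ℝ (Fin d)))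
    (hdisj : ∀ i j, i ≠ j → Disjoint (O i) (O j))
    (C : Finset (EuclideanSpace ℝ (Fin d))) :
    costS (Finset.univ.biUnion O) C = ∑ i, costS (O i) C :=
  Finset.sum_biUnion fun i _ j _ hij => hdisj i j hij

/-- The appendix lemma `bad-swap-inequality++` in generalized form: if for each `i` the
approximate center `ôᵢ` satisfies `cost(Oᵢ, (C \ Out) ∪ {ôᵢ}) ≤ Bᵢ`, and the swap
`({ô₁,…,ô_s}, Out)` fails to decrease the total cost by at least `t`, then
`cost(O_In, C) ≤ Σᵢ Bᵢ + reassign + t`, where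
`reassign = cost(P \ O_In, C \ Out) − cost(P \ O_In, C)`. -/
theorem bad_swap_inequality_pp {d s : ℕ} [DecidableEq (EuclideanSpace ℝ (Fin d))]
    (hs : 0 < s) (t : ℝ) (ht : 0 ≤ t)
    (P C Out : Finset (EuclideanSpace ℝ (Fin d)))
    (hOut : Out ⊆ C) (hCOut : (C \ Out).Nonempty)
    (O : Fin s → Finset (EuclideanSpace ℝ (Fin d)))
    (hOP : ∀ i, O i ⊆ P) (hOne : ∀ i, (O i).Nonempty)
    (hdisj : ∀ i j, i ≠ j → Disjoint (O i) (O j))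
    (ohat : Fin s → EuclideanSpace ℝ (Fin d)) (B : Fin s → ℝ)
    (hB : ∀ i, costS (O i) ((C \ Out) ∪ {ohat i}) ≤ B i)
    (hnotimp : costS P ((C \ Out) ∪ Finset.univ.image ohat) > costS P C - t) :
    costS (Finset.univ.biUnion O) C ≤
      (∑ i, B i) +
        (costS (P \ Finset.univ.biUnion O) (C \ Out) -
          costS (P \ Finset.univ.biUnion O) C) + t := by
  have hsub : Finset.univ.biUnion O ⊆ P := Finset.biUnion_subset.mpr fun i _ => hOP i
  have hIn : costS (Finset.univ.biUnion O) ((C \ Out) ∪ Finset.univ.image ohat) ≤ ∑ i, B i := by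
    rw [costS_biUnion O hdisj]
    refine Finset.sum_le_sum fun i _ => (costS_anti _ ?_ ?_).trans (hB i)
    · exact hCOut.mono Finset.subset_union_left
    · refine Finset.union_subset_union_right (Finset.singleton_subset_iff.mpr ?_)
      exact Finset.mem_image_of_mem _ (Finset.mem_univ i)
  have hRest := costS_anti (P \ Finset.univ.biUnion O) hCOut
    (Finset.subset_union_left (s₂ := Finset.univ.image ohat))
  have hnew := costS_sdiff_add ((C \ Out) ∪ Finset.univ.image ohat) hsub
  have hold := costS_sdiff_add C hsub
  linarith
end

section
/- Let Q be a finite nonempty set of points in EuclideanSpace ℝ (Fin d) with centroid μ(Q), and let m ≥ 1 be a natural number. Then Σ over all functions s : Fin m → Q of ‖(1/m)·Σ_{i} s(i) − μ(Q)‖² equals |Q|^{m−1} · cost(Q, μ(Q)) / m. -/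
open Finset

/-- For a centred finite family of vectors, the sum of `‖∑ i, f (s i)‖²` over all `n`-tuples `s`
of indices: the cross terms cancel. -/
theorem sum_norm_sq_sum_of_sum_eq_zero {E α : Type*} [NormedAddCommGroup E]
    [InnerProductSpace ℝ E] [Fintype α] (f : α → E) (hf : ∑ a, f a = 0) (n : ℕ) :
    ∑ s : Fin n → α, ‖∑ i, f (s i)‖ ^ 2 =
      n * (Fintype.card α : ℝ) ^ (n - 1) * ∑ a, ‖f a‖ ^ 2 := by
  induction n with
  | zero => simp
  | succ n ih =>
    have cross : ∑ a, ∑ s : Fin n → α, 2 * inner ℝ (f a) (∑ i, f (s i)) = 0 := by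
      rw [Finset.sum_comm]
      simp [← Finset.mul_sum, ← sum_inner, hf]
    rw [← (Fin.consEquiv fun _ : Fin (n + 1) => α).sum_comp, Fintype.sum_prod_type]
    simp only [Fin.consEquiv_apply, Fin.sum_univ_succ, Fin.cons_zero, Fin.cons_succ,
      norm_add_sq_real, Finset.sum_add_distrib, cross, ih]
    simp only [Finset.sum_const, Finset.card_univ, Fintype.card_fun, Fintype.card_fin,
      nsmul_eq_mul, ← Finset.mul_sum]
    cases n with
    | zero => simp
    | succ n => simp; ring

/-- Exact expectation identity (counting form): summing over all `m`-tuples of points of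
`Q`, `Σ_s ‖(1/m)·Σᵢ s(i) − μ(Q)‖² = |Q|^{m−1} · cost(Q, μ(Q)) / m`. -/
theorem sample_mean_variance {d m : ℕ} (hm : 1 ≤ m)
    (Q : Finset (EuclideanSpace ℝ (Fin d))) (hQ : Q.Nonempty) :
    ∑ s : Fin m → Q, ‖(m : ℝ)⁻¹ • (∑ i, (s i : EuclideanSpace ℝ (Fin d))) - mu Q‖ ^ 2 =
      (Q.card : ℝ) ^ (m - 1) * cost Q (mu Q) / m := by
  have hm0 : (m : ℝ) ≠ 0 := by positivity
  have hQ0 : (Q.card : ℝ) ≠ 0 := by exact_mod_cast hQ.card_ne_zero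
  have centred : ∑ q : Q, ((q : EuclideanSpace ℝ (Fin d)) - mu Q) = 0 := by
    rw [Finset.sum_coe_sort Q fun q => q - mu Q, Finset.sum_sub_distrib, Finset.sum_const,
      ← Nat.cast_smul_eq_nsmul ℝ, mu, smul_inv_smul₀ hQ0, sub_self]
  have mean_sub (s : Fin m → Q) :
      (m : ℝ)⁻¹ • (∑ i, (s i : EuclideanSpace ℝ (Fin d))) - mu Q =
        (m : ℝ)⁻¹ • ∑ i, ((s i : EuclideanSpace ℝ (Fin d)) - mu Q) := by
    rw [Finset.sum_sub_distrib, smul_sub, Finset.sum_const, Finset.card_univ, Fintype.card_fin,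
      ← Nat.cast_smul_eq_nsmul ℝ, inv_smul_smul₀ hm0]
  simp only [mean_sub, norm_smul, mul_pow, ← Finset.mul_sum]
  rw [sum_norm_sq_sum_of_sum_eq_zero (fun q : Q => (q : EuclideanSpace ℝ (Fin d)) - mu Q) centred,
    Finset.sum_coe_sort Q fun q => ‖q - mu Q‖ ^ 2, Fintype.card_coe, ← cost, norm_inv,
    Real.norm_natCast]
  field_simp
end

section
/- Let q be a point and Z a finite set of points in EuclideanSpace ℝ (Fin d), and let ε > 0 and Γ ≥ 0 be reals with cost(Z, q) ≤ ε²·Γ. Then for every point o: (cost(Z, o) − (ε + ε²)·Γ) / (1 + ε) ≤ |Z| · ‖q − o‖² ≤ (1 + ε)·cost(Z, o) + (ε + ε²)·Γ. -/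
open Finset

/-- A weighted form of the squared triangle inequality. -/
lemma norm_add_sq_le_weighted {E : Type*} [SeminormedAddCommGroup E] (x y : E) {ε : ℝ}
    (hε : 0 < ε) : ‖x + y‖ ^ 2 ≤ (1 + ε) * ‖x‖ ^ 2 + (1 + ε⁻¹) * ‖y‖ ^ 2 := by
  have h : (‖x‖ + ‖y‖) ^ 2 + ε⁻¹ * (ε * ‖x‖ - ‖y‖) ^ 2 =
      (1 + ε) * ‖x‖ ^ 2 + (1 + ε⁻¹) * ‖y‖ ^ 2 := by
    field_simp
    ring
  have hsq : 0 ≤ ε⁻¹ * (ε * ‖x‖ - ‖y‖) ^ 2 := by positivity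
  have htri : ‖x + y‖ ^ 2 ≤ (‖x‖ + ‖y‖) ^ 2 := by
    gcongr
    exact norm_add_le x y
  linarith

/-- The 'as-if-they-were-concentrated' lemma with explicit constants: if
`cost(Z, q) ≤ ε²Γ` then for every center `o`,
`(cost(Z, o) − (ε + ε²)Γ)/(1 + ε) ≤ |Z|·‖q − o‖² ≤ (1 + ε)·cost(Z, o) + (ε + ε²)Γ`. -/
theorem as_if_concentrated {d : ℕ} (q : EuclideanSpace ℝ (Fin d))
    (Z : Finset (EuclideanSpace ℝ (Fin d))) (ε Γ : ℝ) (hε : 0 < ε) (hΓ : 0 ≤ Γ)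
    (hZq : cost Z q ≤ ε ^ 2 * Γ) (o : EuclideanSpace ℝ (Fin d)) :
    (cost Z o - (ε + ε ^ 2) * Γ) / (1 + ε) ≤ (Z.card : ℝ) * ‖q - o‖ ^ 2 ∧
    (Z.card : ℝ) * ‖q - o‖ ^ 2 ≤ (1 + ε) * cost Z o + (ε + ε ^ 2) * Γ := by
  have hadd : (1 + ε⁻¹) * cost Z q ≤ (ε + ε ^ 2) * Γ := by
    calc (1 + ε⁻¹) * cost Z q ≤ (1 + ε⁻¹) * (ε ^ 2 * Γ) := by gcongr
      _ = (ε + ε ^ 2) * Γ := by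
        field_simp
        ring
  have hcard : (Z.card : ℝ) * ‖q - o‖ ^ 2 = ∑ _z ∈ Z, ‖q - o‖ ^ 2 := by
    rw [sum_const, nsmul_eq_mul]
  constructor
  · rw [div_le_iff₀ (by positivity)]
    have h : cost Z o ≤ (1 + ε) * ((Z.card : ℝ) * ‖q - o‖ ^ 2) + (1 + ε⁻¹) * cost Z q := by
      rw [hcard, cost, cost, mul_sum, mul_sum, ← sum_add_distrib]
      refine sum_le_sum fun z _ ↦ ?_
      simpa using norm_add_sq_le_weighted (q - o) (z - q) hε
    linarith
  · have h : (Z.card : ℝ) * ‖q - o‖ ^ 2 ≤ (1 + ε) * cost Z o + (1 + ε⁻¹) * cost Z q := by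
      rw [hcard, cost, cost, mul_sum, mul_sum, ← sum_add_distrib]
      refine sum_le_sum fun z _ ↦ ?_
      simpa [norm_sub_rev q z] using norm_add_sq_le_weighted (z - o) (q - z) hε
    linarith
end

section
/- Let ι be a finite nonempty index type, let x : ι → EuclideanSpace ℝ (Fin d), let ε ∈ (0, 1), and let w, α : ι → ℝ satisfy 0 < w i and w i ≤ α i ≤ w i / (1 − ε) for every i. Define μ := (Σ_i w i • x i) / (Σ_i w i) and μ̂ := (Σ_i α i • x i) / (Σ_i α i). Then Σ_i w i · ‖x i − μ̂‖² ≤ (1/(1 − ε)) · Σ_i w i · ‖x i − μ‖². -/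
open Finset

/-- The weighted mean minimizes the weighted sum of squared distances. -/
theorem sum_mul_norm_sub_weighted_mean_sq_le {E ι : Type*} [NormedAddCommGroup E]
    [InnerProductSpace ℝ E] [Fintype ι] (x : ι → E) (α : ι → ℝ) (hα : 0 < ∑ i, α i) (c : E) :
    ∑ i, α i * ‖x i - (∑ i, α i)⁻¹ • (∑ i, α i • x i)‖ ^ 2 ≤ ∑ i, α i * ‖x i - c‖ ^ 2 := by
  set m := (∑ i, α i)⁻¹ • (∑ i, α i • x i) with hm
  have hzero : ∑ i, α i • (x i - m) = 0 := by
    simp only [smul_sub, sum_sub_distrib, ← sum_smul]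
    rw [hm, smul_inv_smul₀ hα.ne', sub_self]
  have hinner : ∑ i, α i * inner ℝ (x i - m) (m - c) = 0 := by
    simp only [← real_inner_smul_left, ← sum_inner, hzero, inner_zero_left]
  have hsplit : ∑ i, α i * ‖x i - c‖ ^ 2 =
      ∑ i, α i * ‖x i - m‖ ^ 2 + 2 * ∑ i, α i * inner ℝ (x i - m) (m - c) +
        (∑ i, α i) * ‖m - c‖ ^ 2 := by
    rw [mul_sum, sum_mul, ← sum_add_distrib, ← sum_add_distrib]
    refine sum_congr rfl fun i _ => ?_
    rw [← sub_add_sub_cancel (x i) m c, norm_add_sq_real]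
    ring
  rw [hsplit, hinner]
  have : 0 ≤ (∑ i, α i) * ‖m - c‖ ^ 2 := by positivity
  linarith

/-- The appendix lemma 'alpha-are-off-its-ok' with the `O(ε)` factor made explicit:
perturbing each weight multiplicatively within `[1, 1/(1−ε)]` changes the quality of the
weighted mean as a 1-means center by at most a factor `1/(1−ε)`. -/
theorem perturbed_weights_ok {d : ℕ} {ι : Type*} [Fintype ι] [Nonempty ι]
    (x : ι → EuclideanSpace ℝ (Fin d)) (ε : ℝ) (hε0 : 0 < ε) (hε1 : ε < 1)
    (w α : ι → ℝ) (hw : ∀ i, 0 < w i)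
    (hlow : ∀ i, w i ≤ α i) (hhigh : ∀ i, α i ≤ w i / (1 - ε)) :
    ∑ i, w i * ‖x i - (∑ i, α i)⁻¹ • (∑ i, α i • x i)‖ ^ 2 ≤
      (1 / (1 - ε)) * ∑ i, w i * ‖x i - (∑ i, w i)⁻¹ • (∑ i, w i • x i)‖ ^ 2 := by
  have hα : 0 < ∑ i, α i := sum_pos (fun i _ => (hw i).trans_le (hlow i)) univ_nonempty
  calc
    _ ≤ ∑ i, α i * ‖x i - (∑ i, α i)⁻¹ • (∑ i, α i • x i)‖ ^ 2 :=
      sum_le_sum fun i _ => mul_le_mul_of_nonneg_right (hlow i) (sq_nonneg _)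
    _ ≤ ∑ i, α i * ‖x i - (∑ i, w i)⁻¹ • (∑ i, w i • x i)‖ ^ 2 :=
      sum_mul_norm_sub_weighted_mean_sq_le x α hα _
    _ ≤ ∑ i, w i / (1 - ε) * ‖x i - (∑ i, w i)⁻¹ • (∑ i, w i • x i)‖ ^ 2 :=
      sum_le_sum fun i _ => mul_le_mul_of_nonneg_right (hhigh i) (sq_nonneg _)
    _ = _ := by
      rw [mul_sum]
      exact sum_congr rfl fun i _ => by ring
end
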